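/- Let k > 1 be an integer and let α be a real number with 0 ≤ α < 0.46. Then there exist an open neighborhood V_α of the origin in ℂ^{2k} and a smooth function ρ_α : V_α → ℝ, plurisubharmonic on V_α, such that: {ρ_α = 0} = S_α ∩ V_α; ρ_α > 0 on V_α \ S_α; and ρ_α is strictly plurisubharmonic at every point of V_α \ Y. -/

import Mathlib

open scoped Manifold ComplexConjugate

noncomputable section

/-- Evaluation of a holomorphic polynomial on `ℂ^n`. -/
def evalPoly {n : ℕ} (P : MvPolynomial (Fin n) ℂ) (z : EuclideanSpace ℂ (Fin n)) : ℂ :=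
  MvPolynomial.eval (fun i => z i) P

/-- The polynomially convex hull of a set `K ⊆ ℂ^n`. -/
def polyHull {n : ℕ} (K : Set (EuclideanSpace ℂ (Fin n))) : Set (EuclideanSpace ℂ (Fin n)) :=
  {z | ∀ P : MvPolynomial (Fin n) ℂ, ‖evalPoly P z‖ ≤ ⨆ w ∈ K, ‖evalPoly P w‖}

/-- A set is polynomially convex if it coincides with its polynomially convex hull. -/
def IsPolyConvex {n : ℕ} (K : Set (EuclideanSpace ℂ (Fin n))) : Prop := polyHull K = K

/-- The rationally convex hull of a set `K ⊆ ℂ^n`. -/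
def ratHull {n : ℕ} (K : Set (EuclideanSpace ℂ (Fin n))) : Set (EuclideanSpace ℂ (Fin n)) :=
  {z | ∀ P : MvPolynomial (Fin n) ℂ, evalPoly P z = 0 → ∃ w ∈ K, evalPoly P w = 0}

/-- The closed half-space `{x ∈ ℝ^d : x₀ ≥ 0}`. -/
def halfSpace (d : ℕ) (hd : 0 < d) : Set (EuclideanSpace ℝ (Fin d)) :=
  {x | 0 ≤ x ⟨0, hd⟩}

/-- `M ⊆ ℂ^n` is a `d`-dimensional smooth compact submanifold (possibly with boundary):
every point admits a smooth local parametrization by a relatively open subset of the closed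
half-space `H ⊆ ℝ^d`, which is an immersion and a homeomorphism onto a relatively open
subset of `M`. (Charts with image in the open half-space cover interior points, so closed
submanifolds are included.) -/
def IsSubmanifold {n : ℕ} (d : ℕ) (hd : 0 < d) (M : Set (EuclideanSpace ℂ (Fin n))) : Prop :=
  ∀ p ∈ M, ∃ (V : Set (EuclideanSpace ℝ (Fin d))) (U : Set (EuclideanSpace ℂ (Fin n)))
    (f : EuclideanSpace ℝ (Fin d) → EuclideanSpace ℂ (Fin n)),
    IsOpen V ∧ IsOpen U ∧ p ∈ U ∧ ContDiffOn ℝ (⊤ : ℕ∞) f V ∧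
    Set.InjOn f (V ∩ halfSpace d hd) ∧
    (∀ x ∈ V, Function.Injective (fderiv ℝ f x)) ∧
    f '' (V ∩ halfSpace d hd) = M ∩ U ∧
    (∀ W, IsOpen W → W ⊆ V → ∃ U', IsOpen U' ∧ f '' (W ∩ halfSpace d hd) = M ∩ U')

/-- `p` is a boundary point of the submanifold `M`: some local parametrization as above
maps a point on the boundary of the half-space to `p`. -/
def IsBoundaryPoint {n : ℕ} (d : ℕ) (hd : 0 < d) (M : Set (EuclideanSpace ℂ (Fin n)))
    (p : EuclideanSpace ℂ (Fin n)) : Prop :=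
  p ∈ M ∧ ∃ (V : Set (EuclideanSpace ℝ (Fin d))) (U : Set (EuclideanSpace ℂ (Fin n)))
    (f : EuclideanSpace ℝ (Fin d) → EuclideanSpace ℂ (Fin n)),
    IsOpen V ∧ IsOpen U ∧ p ∈ U ∧ ContDiffOn ℝ (⊤ : ℕ∞) f V ∧
    Set.InjOn f (V ∩ halfSpace d hd) ∧
    (∀ x ∈ V, Function.Injective (fderiv ℝ f x)) ∧
    f '' (V ∩ halfSpace d hd) = M ∩ U ∧
    (∀ W, IsOpen W → W ⊆ V → ∃ U', IsOpen U' ∧ f '' (W ∩ halfSpace d hd) = M ∩ U') ∧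
    ∃ x ∈ V ∩ halfSpace d hd, f x = p ∧ x ⟨0, hd⟩ = 0

/-- The tangent space of `M ⊆ ℂ^n` at `p`, as a real subspace of `ℂ^n`. -/
def tangentSpaceAt {n : ℕ} (M : Set (EuclideanSpace ℂ (Fin n)))
    (p : EuclideanSpace ℂ (Fin n)) : Submodule ℝ (EuclideanSpace ℂ (Fin n)) :=
  Submodule.span ℝ (tangentConeAt ℝ M p)

/-- `M` is totally real at `p`: `T_pM ∩ i·T_pM = {0}`. -/
def TotallyRealAt {n : ℕ} (M : Set (EuclideanSpace ℂ (Fin n)))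
    (p : EuclideanSpace ℂ (Fin n)) : Prop :=
  ∀ v ∈ tangentSpaceAt M p, Complex.I • v ∈ tangentSpaceAt M p → v = (0 : EuclideanSpace ℂ (Fin n))

/-- The Beloshapka–Coffman normal form `𝓜_k ⊆ ℂ^{3k-1}`, in coordinates
`Z = (z, w₁, …, w_{2k-2}, ζ₁, …, ζ_k)`, `w_τ = u_τ + i v_τ`. -/
def bcForm (k : ℕ) (hk : 1 < k) : Set (EuclideanSpace ℂ (Fin (3*k-1))) :=
  {Z | (∀ τ : ℕ, ∀ _h1 : 1 ≤ τ, ∀ _h2 : τ ≤ 2*k-2, (Z ⟨τ, by omega⟩).im = 0) ∧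
    Z ⟨2*k-1, by omega⟩ = (Complex.normSq (Z ⟨0, by omega⟩) : ℂ) +
      conj (Z ⟨0, by omega⟩) * (((Z ⟨1, by omega⟩).re : ℂ) + Complex.I * ((Z ⟨2, by omega⟩).re : ℂ)) ∧
    (∀ σ : ℕ, ∀ _h1 : 2 ≤ σ, ∀ _h2 : σ ≤ k-1,
      Z ⟨2*k-2+σ, by omega⟩ = conj (Z ⟨0, by omega⟩) *
        (((Z ⟨2*σ-1, by omega⟩).re : ℂ) + Complex.I * ((Z ⟨2*σ, by omega⟩).re : ℂ))) ∧
    Z ⟨3*k-2, by omega⟩ = (conj (Z ⟨0, by omega⟩))^2}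

/-- `p` is a generic CR-singularity of `M ⊆ ℂ^{3k-1}`: `(M, p)` is locally biholomorphic
to `(𝓜_k, O)`. -/
def IsGenericCRSingularity (k : ℕ) (hk : 1 < k) (M : Set (EuclideanSpace ℂ (Fin (3*k-1))))
    (p : EuclideanSpace ℂ (Fin (3*k-1))) : Prop :=
  ∃ (U V : Set (EuclideanSpace ℂ (Fin (3*k-1))))
    (Φ Ψ : EuclideanSpace ℂ (Fin (3*k-1)) → EuclideanSpace ℂ (Fin (3*k-1))),
    IsOpen U ∧ IsOpen V ∧ p ∈ U ∧ (0 : EuclideanSpace ℂ (Fin (3*k-1))) ∈ V ∧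
    DifferentiableOn ℂ Φ U ∧ DifferentiableOn ℂ Ψ V ∧
    Set.MapsTo Φ U V ∧ Set.MapsTo Ψ V U ∧
    (∀ x ∈ U, Ψ (Φ x) = x) ∧ (∀ y ∈ V, Φ (Ψ y) = y) ∧
    Φ p = 0 ∧ Φ '' (M ∩ U) = bcForm k hk ∩ V

/-- The Laplacian at `0` of the slice function `λ ↦ ρ(p + λ·v)`. -/
def sliceLaplacian {n : ℕ} (ρ : EuclideanSpace ℂ (Fin n) → ℝ)
    (p v : EuclideanSpace ℂ (Fin n)) : ℝ :=
  iteratedFDeriv ℝ 2 (fun lam : ℂ => ρ (p + lam • v)) 0 ![1, 1]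
  + iteratedFDeriv ℝ 2 (fun lam : ℂ => ρ (p + lam • v)) 0 ![Complex.I, Complex.I]

/-- `ρ` is plurisubharmonic on `U`. -/
def PshOn {n : ℕ} (ρ : EuclideanSpace ℂ (Fin n) → ℝ) (U : Set (EuclideanSpace ℂ (Fin n))) : Prop :=
  ∀ p ∈ U, ∀ v : EuclideanSpace ℂ (Fin n), 0 ≤ sliceLaplacian ρ p v

/-- `ρ` is strictly plurisubharmonic at `p`. -/
def StrictPshAt {n : ℕ} (ρ : EuclideanSpace ℂ (Fin n) → ℝ)
    (p : EuclideanSpace ℂ (Fin n)) : Prop :=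
  ∀ v : EuclideanSpace ℂ (Fin n), v ≠ 0 → 0 < sliceLaplacian ρ p v

/-- `ρ` is strictly plurisubharmonic on a set. -/
def StrictPshOn {n : ℕ} (ρ : EuclideanSpace ℂ (Fin n) → ℝ)
    (U : Set (EuclideanSpace ℂ (Fin n))) : Prop :=
  ∀ p ∈ U, StrictPshAt ρ p

/-- The manifold `S_α ⊆ ℂ^{2k}`: `Im w₁ = ⋯ = Im w_{2k-2} = 0` and
`w = (α/2)|z|² + (1/4)(z² + conj(z)²)`, in coordinates `Z' = (z, w₁, …, w_{2k-2}, w)`. -/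
def slaparSurface (k : ℕ) (hk : 1 < k) (α : ℝ) : Set (EuclideanSpace ℂ (Fin (2*k))) :=
  {Z | (∀ τ : ℕ, ∀ _h1 : 1 ≤ τ, ∀ _h2 : τ ≤ 2*k-2, (Z ⟨τ, by omega⟩).im = 0) ∧
    Z ⟨2*k-1, by omega⟩ = ((α/2 * Complex.normSq (Z ⟨0, by omega⟩) : ℝ) : ℂ)
      + (1/4 : ℂ) * ((Z ⟨0, by omega⟩)^2 + (conj (Z ⟨0, by omega⟩))^2)}

/-- The set `Y = {z = 0, Im w₁ = ⋯ = Im w_{2k-2} = 0, w = 0} ⊆ ℂ^{2k}`. -/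
def slaparSingularSet (k : ℕ) (hk : 1 < k) : Set (EuclideanSpace ℂ (Fin (2*k))) :=
  {Z | Z ⟨0, by omega⟩ = 0 ∧
    (∀ τ : ℕ, ∀ _h1 : 1 ≤ τ, ∀ _h2 : τ ≤ 2*k-2, (Z ⟨τ, by omega⟩).im = 0) ∧
    Z ⟨2*k-1, by omega⟩ = 0}

/-- `h` has value `a`, first derivative `b` and second derivative `c` at the origin. -/
def HasTwoJet (h : ℝ → ℝ) (a b c : ℝ) : Prop :=
  ∃ h' : ℝ → ℝ, (∀ t, HasDerivAt h (h' t) t) ∧ HasDerivAt h' c 0 ∧ h 0 = a ∧ h' 0 = b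

namespace HasTwoJet

theorem congr_jet {h : ℝ → ℝ} {a b c a' b' c' : ℝ} (H : HasTwoJet h a b c)
    (ha : a = a') (hb : b = b') (hc : c = c') : HasTwoJet h a' b' c' := by
  subst ha hb hc; exact H

theorem const (a : ℝ) : HasTwoJet (fun _ => a) a 0 0 :=
  ⟨fun _ => 0, fun t => hasDerivAt_const t a, hasDerivAt_const 0 0, rfl, rfl⟩

theorem line (a b : ℝ) : HasTwoJet (fun t => a + t * b) a b 0 := by
  refine ⟨fun _ => b, fun t => ?_, hasDerivAt_const 0 b, by simp, rfl⟩
  simpa using ((hasDerivAt_id t).mul_const b).const_add a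

theorem add {f g : ℝ → ℝ} {a b c a' b' c' : ℝ} (F : HasTwoJet f a b c)
    (G : HasTwoJet g a' b' c') :
    HasTwoJet (fun t => f t + g t) (a + a') (b + b') (c + c') := by
  obtain ⟨f', hf, hf', rfl, rfl⟩ := F
  obtain ⟨g', hg, hg', rfl, rfl⟩ := G
  exact ⟨fun t => f' t + g' t, fun t => (hf t).add (hg t), hf'.add hg', rfl, rfl⟩

theorem mul {f g : ℝ → ℝ} {a b c a' b' c' : ℝ} (F : HasTwoJet f a b c)
    (G : HasTwoJet g a' b' c') :
    HasTwoJet (fun t => f t * g t) (a * a') (b * a' + a * b')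
      (c * a' + 2 * b * b' + a * c') := by
  obtain ⟨f', hf, hf', rfl, rfl⟩ := F
  obtain ⟨g', hg, hg', rfl, rfl⟩ := G
  refine ⟨fun t => f' t * g t + f t * g' t, fun t => (hf t).mul (hg t), ?_, rfl, rfl⟩
  exact ((hf'.mul (hg 0)).add ((hf 0).mul hg')).congr_deriv (by ring)

theorem const_mul {f : ℝ → ℝ} {a b c : ℝ} (k : ℝ) (F : HasTwoJet f a b c) :
    HasTwoJet (fun t => k * f t) (k * a) (k * b) (k * c) :=
  ((const k).mul F).congr_jet rfl (by ring) (by ring)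

theorem sub {f g : ℝ → ℝ} {a b c a' b' c' : ℝ} (F : HasTwoJet f a b c)
    (G : HasTwoJet g a' b' c') :
    HasTwoJet (fun t => f t - g t) (a - a') (b - b') (c - c') := by
  obtain ⟨f', hf, hf', rfl, rfl⟩ := F
  obtain ⟨g', hg, hg', rfl, rfl⟩ := G
  exact ⟨fun t => f' t - g' t, fun t => (hf t).sub (hg t), hf'.sub hg', rfl, rfl⟩

theorem sq {f : ℝ → ℝ} {a b c : ℝ} (F : HasTwoJet f a b c) :
    HasTwoJet (fun t => f t ^ 2) (a ^ 2) (2 * a * b) (2 * b ^ 2 + 2 * a * c) := by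
  simp only [pow_two]
  exact (F.mul F).congr_jet rfl (by ring) (by ring)

theorem sum {ι : Type*} (s : Finset ι) {f : ι → ℝ → ℝ} {a b c : ι → ℝ}
    (F : ∀ i ∈ s, HasTwoJet (f i) (a i) (b i) (c i)) :
    HasTwoJet (fun t => ∑ i ∈ s, f i t) (∑ i ∈ s, a i) (∑ i ∈ s, b i) (∑ i ∈ s, c i) := by
  classical
  induction s using Finset.induction_on with
  | empty => simpa using const 0
  | insert i s hi ih =>
    simp only [Finset.sum_insert hi]
    exact (F i (Finset.mem_insert_self i s)).add
      (ih fun j hj => F j (Finset.mem_insert_of_mem hj))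

/-- The diagonal second derivative of a `C²` function is read off from its two-jet along a line. -/
theorem iteratedFDeriv_two {E : Type*} [NormedAddCommGroup E] [NormedSpace ℝ E] {g : E → ℝ}
    (hg : ContDiff ℝ 2 g) {e : E} {a b c : ℝ} (H : HasTwoJet (fun t => g (t • e)) a b c) :
    iteratedFDeriv ℝ 2 g 0 ![e, e] = c := by
  obtain ⟨h', hh, hh', -, -⟩ := H
  have hline (t : ℝ) : HasDerivAt (fun t : ℝ => t • e) e t := by
    simpa using (hasDerivAt_id t).smul_const e
  have hd : Differentiable ℝ g := hg.differentiable (by norm_num)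
  have hd' : Differentiable ℝ (fderiv ℝ g) :=
    (hg.fderiv_right (m := 1) (by norm_num)).differentiable (by norm_num)
  have hh'_eq : h' = fun t : ℝ => fderiv ℝ g (t • e) e := by
    funext t
    exact (hh t).unique ((hd (t • e)).hasFDerivAt.comp_hasDerivAt t (hline t))
  have h2 : HasDerivAt h' (fderiv ℝ (fderiv ℝ g) ((0 : ℝ) • e) e e) 0 := by
    rw [hh'_eq]
    have := (hd' ((0 : ℝ) • e)).hasFDerivAt.comp_hasDerivAt (0 : ℝ) (hline 0)
    simpa using this.clm_apply (hasDerivAt_const (0 : ℝ) e)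
  rw [iteratedFDeriv_two_apply]
  simpa using h2.unique hh'

end HasTwoJet

theorem quadratic_nonneg_of_disc {P Q R : ℝ} (hP : 0 < P) (h : Q ^ 2 ≤ 4 * P * R) (u : ℝ) :
    0 ≤ P * u ^ 2 + Q * u + R := by
  have : 0 ≤ 4 * P * (P * u ^ 2 + Q * u + R) := by nlinarith [sq_nonneg (2 * P * u + Q)]
  exact nonneg_of_mul_nonneg_right this (by positivity)

/-- For `m = x⁴ + 60x²y² + 4y⁴` and `q = ((1+α)x² - (1-α)y²)/2`, with `X = x²`, `Y = y²`, the
right side minus the left side is, for each fixed `u`, a lower bound for the Laplacian of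
`m (u - q)²`. -/
theorem laplacian_weight_mul_sq_ge {α X Y : ℝ} (u : ℝ) (h0 : 0 ≤ α) (h1 : α < 0.46)
    (hX : 0 ≤ X) (hY : 0 ≤ Y) :
    4 / 5 * (X + Y) * (u ^ 2 + (X + Y) ^ 2) ≤
      (132 * X + 168 * Y) * (u - ((1 + α) * X - (1 - α) * Y) / 2) ^ 2
      - 4 * (u - ((1 + α) * X - (1 - α) * Y) / 2) *
        ((1 + α) * (4 * X ^ 2 + 120 * X * Y) - (1 - α) * (120 * X * Y + 16 * Y ^ 2))
      + 2 * (X ^ 2 + 60 * X * Y + 4 * Y ^ 2) *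
        ((1 + α) ^ 2 * X + (1 - α) ^ 2 * Y
          - 2 * α * (u - ((1 + α) * X - (1 - α) * Y) / 2)) := by
  rcases eq_or_lt_of_le (add_nonneg hX hY) with hs | hs
  · have hX0 : X = 0 := by linarith
    have hY0 : Y = 0 := by linarith
    subst hX0 hY0; simp
  have hP : 0 < 4 * (164 / 5 * X + 209 / 5 * Y) := by linarith
  have hα2 : α ^ 2 ≤ 0.2116 := by nlinarith
  have hXY : 0 ≤ X * Y := mul_nonneg hX hY
  have hdisc : (4 * ((-37 - 38 * α) * X ^ 2 + (-9 - 375 * α) * (X * Y)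
        + (58 - 62 * α) * Y ^ 2)) ^ 2 ≤
      4 * (4 * (164 / 5 * X + 209 / 5 * Y)) *
        (4 * ((211 / 20 + 22 * α + 45 / 4 * α ^ 2) * X ^ 3
          + (219 / 10 + 459 / 2 * α + 210 * α ^ 2) * (X ^ 2 * Y)
          + (213 / 20 - 441 / 2 * α + 885 / 4 * α ^ 2) * (X * Y ^ 2)
          + (203 / 10 - 43 * α + 45 / 2 * α ^ 2) * Y ^ 3)) := by
    have c40 : 0 ≤ 379 / 25 + 372 / 5 * α + 32 * α ^ 2 := by positivity
    have c04 : 0 ≤ 754 / 25 + 12 / 5 * α - 82 * α ^ 2 := by linarith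
    have c31 : 3900 ≤ 99281 / 25 + 26774 / 5 * α + 933 * α ^ 2 := by
      linarith [sq_nonneg α]
    have c22 : -6800 ≤ 231749 / 25 + 12564 / 5 * α - 81197 * α ^ 2 := by nlinarith
    have c13 : 4000 ≤ 137201 / 25 - 626 / 5 * α - 6555 * α ^ 2 := by linarith
    have t40 := mul_nonneg c40 (pow_nonneg hX 4)
    have t04 := mul_nonneg c04 (pow_nonneg hY 4)
    have t31 := mul_le_mul_of_nonneg_right c31 (mul_nonneg hXY (sq_nonneg X))
    have t22 := mul_le_mul_of_nonneg_right c22 (mul_nonneg hXY hXY)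
    have t13 := mul_le_mul_of_nonneg_right c13 (mul_nonneg hXY (sq_nonneg Y))
    have hq : 0 ≤ X * Y * (3900 * X ^ 2 - 6800 * (X * Y) + 4000 * Y ^ 2) :=
      mul_nonneg hXY (by nlinarith [sq_nonneg (X - Y), sq_nonneg X, sq_nonneg Y])
    linarith
  linarith [quadratic_nonneg_of_disc hP hdisc u]

/-- Cauchy-Schwarz for the mixed term of a Levi form. -/
theorem mixed_term_ge {b₁ b₂ w e : ℝ} (hw : 0 ≤ w) (he : 0 ≤ e) (hb : b₁ ^ 2 + b₂ ^ 2 ≤ w * e)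
    (ξ₁ ξ₂ η₁ η₂ : ℝ) :
    -(w * (ξ₁ ^ 2 + ξ₂ ^ 2) + e * (η₁ ^ 2 + η₂ ^ 2)) ≤
      2 * (b₁ * (ξ₁ * η₁ + ξ₂ * η₂) + b₂ * (ξ₂ * η₁ - ξ₁ * η₂)) := by
  have hA : 0 ≤ w * (ξ₁ ^ 2 + ξ₂ ^ 2) + e * (η₁ ^ 2 + η₂ ^ 2) := by positivity
  refine (abs_le_of_sq_le_sq' ?_ hA).1
  have h1 : (b₁ * (ξ₁ * η₁ + ξ₂ * η₂) + b₂ * (ξ₂ * η₁ - ξ₁ * η₂)) ^ 2 ≤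
      (b₁ ^ 2 + b₂ ^ 2) * ((ξ₁ ^ 2 + ξ₂ ^ 2) * (η₁ ^ 2 + η₂ ^ 2)) := by
    nlinarith [sq_nonneg (b₁ * (ξ₂ * η₁ - ξ₁ * η₂) - b₂ * (ξ₁ * η₁ + ξ₂ * η₂))]
  have h2 : (b₁ ^ 2 + b₂ ^ 2) * ((ξ₁ ^ 2 + ξ₂ ^ 2) * (η₁ ^ 2 + η₂ ^ 2)) ≤
      w * e * ((ξ₁ ^ 2 + ξ₂ ^ 2) * (η₁ ^ 2 + η₂ ^ 2)) := by gcongr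
  nlinarith [sq_nonneg (w * (ξ₁ ^ 2 + ξ₂ ^ 2) - e * (η₁ ^ 2 + η₂ ^ 2))]

/-- The second derivative of `m (u - q)²` in the direction `(x₁, y₁, u₁)`. -/
def weightSqSecond (α x y u x₁ y₁ u₁ : ℝ) : ℝ :=
  ((2 * (2 * x * x₁) ^ 2 + 2 * x ^ 2 * (2 * x₁ ^ 2))
      + 60 * (2 * x₁ ^ 2 * y ^ 2 + 2 * (2 * x * x₁) * (2 * y * y₁) + x ^ 2 * (2 * y₁ ^ 2))
      + 4 * (2 * (2 * y * y₁) ^ 2 + 2 * y ^ 2 * (2 * y₁ ^ 2)))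
      * (u - ((1 + α) * x ^ 2 - (1 - α) * y ^ 2) / 2) ^ 2
    + 2 * (2 * x ^ 2 * (2 * x * x₁) + 60 * (2 * x * x₁ * y ^ 2 + x ^ 2 * (2 * y * y₁))
        + 4 * (2 * y ^ 2 * (2 * y * y₁)))
      * (2 * (u - ((1 + α) * x ^ 2 - (1 - α) * y ^ 2) / 2)
        * (u₁ - ((1 + α) * x * x₁ - (1 - α) * y * y₁)))
    + ((x ^ 2) ^ 2 + 60 * (x ^ 2 * y ^ 2) + 4 * (y ^ 2) ^ 2)
      * (2 * (u₁ - ((1 + α) * x * x₁ - (1 - α) * y * y₁)) ^ 2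
        + 2 * (u - ((1 + α) * x ^ 2 - (1 - α) * y ^ 2) / 2)
          * (-((1 + α) * x₁ ^ 2 - (1 - α) * y₁ ^ 2)))

theorem quadForm_sq_le {α : ℝ} (h0 : 0 ≤ α) (h1 : α < 0.46) (x y : ℝ) :
    (((1 + α) * x ^ 2 - (1 - α) * y ^ 2) / 2) ^ 2 ≤ (x ^ 2 + y ^ 2) ^ 2 := by
  apply sq_le_sq'
  · nlinarith [sq_nonneg x, sq_nonneg y, mul_nonneg h0 (sq_nonneg x), mul_nonneg h0 (sq_nonneg y)]
  · nlinarith [sq_nonneg x, sq_nonneg y, mul_nonneg h0 (sq_nonneg x), mul_nonneg h0 (sq_nonneg y)]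

theorem weightSq_mixed_sq_le {α : ℝ} (h0 : 0 ≤ α) (h1 : α < 0.46) (x y u : ℝ) :
    (2 * ((4 * x ^ 3 + 120 * x * y ^ 2) * (u - ((1 + α) * x ^ 2 - (1 - α) * y ^ 2) / 2)
        - (x ^ 4 + 60 * x ^ 2 * y ^ 2 + 4 * y ^ 4) * ((1 + α) * x))) ^ 2
      + (2 * ((120 * x ^ 2 * y + 16 * y ^ 3) * (u - ((1 + α) * x ^ 2 - (1 - α) * y ^ 2) / 2)
        + (x ^ 4 + 60 * x ^ 2 * y ^ 2 + 4 * y ^ 4) * ((1 - α) * y))) ^ 2 ≤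
      1 / 5 * (x ^ 2 + y ^ 2) * (u ^ 2 + (x ^ 2 + y ^ 2) ^ 2)
        * (1300000 * (x ^ 2 + y ^ 2) ^ 2) := by
  have hr : (u - ((1 + α) * x ^ 2 - (1 - α) * y ^ 2) / 2) ^ 2 ≤
      2 * (u ^ 2 + (x ^ 2 + y ^ 2) ^ 2) := by
    nlinarith [quadForm_sq_le h0 h1 x y,
      sq_nonneg (u + ((1 + α) * x ^ 2 - (1 - α) * y ^ 2) / 2)]
  generalize u - ((1 + α) * x ^ 2 - (1 - α) * y ^ 2) / 2 = r at hr ⊢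
  have hX := sq_nonneg x
  have hY := sq_nonneg y
  have hm0 : 0 ≤ x ^ 4 + 60 * x ^ 2 * y ^ 2 + 4 * y ^ 4 := by positivity
  have hm1 : x ^ 4 + 60 * x ^ 2 * y ^ 2 + 4 * y ^ 4 ≤ 32 * (x ^ 2 + y ^ 2) ^ 2 := by
    nlinarith [mul_nonneg hX hY, sq_nonneg (x ^ 2), sq_nonneg (y ^ 2)]
  have hm : (x ^ 4 + 60 * x ^ 2 * y ^ 2 + 4 * y ^ 4) ^ 2 ≤ (32 * (x ^ 2 + y ^ 2) ^ 2) ^ 2 :=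
    pow_le_pow_left₀ hm0 hm1 2
  have hgm : (4 * x ^ 3 + 120 * x * y ^ 2) ^ 2 + (120 * x ^ 2 * y + 16 * y ^ 3) ^ 2 ≤
      14400 * (x ^ 2 + y ^ 2) ^ 3 := by
    have : 0 ≤ x ^ 6 := by positivity
    have : 0 ≤ y ^ 6 := by positivity
    have : 0 ≤ x ^ 2 * y ^ 4 := by positivity
    have : 0 ≤ x ^ 4 * y ^ 2 := by positivity
    linarith
  have hgq : ((1 + α) * x) ^ 2 + ((1 - α) * y) ^ 2 ≤ 3 * (x ^ 2 + y ^ 2) := by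
    have : (1 + α) ^ 2 ≤ 3 := by nlinarith
    have : (1 - α) ^ 2 ≤ 3 := by nlinarith
    nlinarith
  generalize x ^ 4 + 60 * x ^ 2 * y ^ 2 + 4 * y ^ 4 = m at *
  generalize 4 * x ^ 3 + 120 * x * y ^ 2 = m₁ at *
  generalize 120 * x ^ 2 * y + 16 * y ^ 3 = m₂ at *
  generalize (1 + α) * x = q₁ at *
  generalize (1 - α) * y = q₂ at *
  have hs : 0 ≤ x ^ 2 + y ^ 2 := by positivity
  generalize x ^ 2 + y ^ 2 = s at *
  calc (2 * (m₁ * r - m * q₁)) ^ 2 + (2 * (m₂ * r + m * q₂)) ^ 2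
      ≤ 8 * ((m₁ ^ 2 + m₂ ^ 2) * r ^ 2 + m ^ 2 * (q₁ ^ 2 + q₂ ^ 2)) := by
        nlinarith [sq_nonneg (m₁ * r + m * q₁), sq_nonneg (m₂ * r - m * q₂)]
    _ ≤ 8 * (14400 * s ^ 3 * (2 * (u ^ 2 + s ^ 2)) + (32 * s ^ 2) ^ 2 * (3 * s)) := by
        gcongr
    _ ≤ 1 / 5 * s * (u ^ 2 + s ^ 2) * (1300000 * s ^ 2) := by
        have : 0 ≤ s ^ 5 := by positivity
        have : 0 ≤ s ^ 3 * u ^ 2 := by positivity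
        linarith

theorem weightSqSecond_add_ge {α : ℝ} (h0 : 0 ≤ α) (h1 : α < 0.46) (x y u ξ₁ ξ₂ η₁ η₂ : ℝ) :
    3 / 5 * (x ^ 2 + y ^ 2) * (u ^ 2 + (x ^ 2 + y ^ 2) ^ 2) * (ξ₁ ^ 2 + ξ₂ ^ 2)
        - 1300000 * (x ^ 2 + y ^ 2) ^ 2 * (η₁ ^ 2 + η₂ ^ 2) ≤
      weightSqSecond α x y u ξ₁ ξ₂ η₁ + weightSqSecond α x y u (-ξ₂) ξ₁ (-η₂) := by
  have ha := mul_le_mul_of_nonneg_right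
    (laplacian_weight_mul_sq_ge u h0 h1 (sq_nonneg x) (sq_nonneg y))
    (add_nonneg (sq_nonneg ξ₁) (sq_nonneg ξ₂))
  have hb := mixed_term_ge (by positivity) (by positivity) (weightSq_mixed_sq_le h0 h1 x y u)
    ξ₁ ξ₂ η₁ η₂
  have hm : 0 ≤ 2 * (x ^ 4 + 60 * x ^ 2 * y ^ 2 + 4 * y ^ 4) * (η₁ ^ 2 + η₂ ^ 2) := by positivity
  unfold weightSqSecond
  linarith

/-- The second derivative of `v² (x² + y²)²` in the direction `(x₁, y₁, v₁)`. -/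
def imSqSecond (x y v x₁ y₁ v₁ : ℝ) : ℝ :=
  2 * v₁ ^ 2 * (x ^ 2 + y ^ 2) ^ 2
    + 2 * (2 * v * v₁) * (2 * (x ^ 2 + y ^ 2) * (2 * x * x₁ + 2 * y * y₁))
    + v ^ 2 * (2 * (2 * x * x₁ + 2 * y * y₁) ^ 2
      + 2 * (x ^ 2 + y ^ 2) * (2 * x₁ ^ 2 + 2 * y₁ ^ 2))

theorem imSqSecond_add_ge (x y v ξ₁ ξ₂ η₁ η₂ : ℝ) :
    10 ^ 6 * (16 * (x ^ 2 + y ^ 2) * v ^ 2 * (ξ₁ ^ 2 + ξ₂ ^ 2)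
        + 2 * (x ^ 2 + y ^ 2) ^ 2 * (η₁ ^ 2 + η₂ ^ 2))
        - 1 / 5 * (x ^ 2 + y ^ 2) ^ 3 * (ξ₁ ^ 2 + ξ₂ ^ 2)
        - 320 * 10 ^ 12 * v ^ 2 * (η₁ ^ 2 + η₂ ^ 2) ≤
      10 ^ 6 * (imSqSecond x y v ξ₁ ξ₂ η₂ + imSqSecond x y v (-ξ₂) ξ₁ η₁) := by
  have hb := mixed_term_ge (b₁ := 10 ^ 6 * (8 * v * (x ^ 2 + y ^ 2) * y))
    (b₂ := 10 ^ 6 * (-(8 * v * (x ^ 2 + y ^ 2) * x)))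
    (w := 1 / 5 * (x ^ 2 + y ^ 2) ^ 3) (e := 320 * 10 ^ 12 * v ^ 2)
    (by positivity) (by positivity) (le_of_eq (by ring)) ξ₁ ξ₂ η₁ η₂
  unfold imSqSecond
  linarith

/-- The second derivative of `s T² + 1000 T³`, `T = r² + v²`, in terms of the two-jets of
`s`, `r` and `v`, the second derivative of the latter being zero. -/
def distSecond (s s₁ s₂ r r₁ r₂ v v₁ : ℝ) : ℝ :=
  s₂ * (r ^ 2 + v ^ 2) ^ 2
    + 2 * s₁ * (2 * (r ^ 2 + v ^ 2) * (2 * r * r₁ + 2 * v * v₁))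
    + s * (2 * (2 * r * r₁ + 2 * v * v₁) ^ 2
      + 2 * (r ^ 2 + v ^ 2) * ((2 * r₁ ^ 2 + 2 * r * r₂) + 2 * v₁ ^ 2))
    + 1000 * (6 * (r ^ 2 + v ^ 2) * (2 * r * r₁ + 2 * v * v₁) ^ 2
      + 3 * (r ^ 2 + v ^ 2) ^ 2 * ((2 * r₁ ^ 2 + 2 * r * r₂) + 2 * v₁ ^ 2))

theorem distSecond_add_ge {α s s₁ s₂ s₁' s₂' r r₁ r₂ r₁' r₂' v v₁ v₁' X : ℝ}
    (h0 : 0 ≤ α) (h1 : α < 0.46) (hs : 0 ≤ s) (hX : 0 ≤ X)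
    (hr : |r| ≤ 1 / 10000) (hr₂ : r₂ + r₂' = -(2 * α * X)) (hs₂ : s₂ + s₂' = 4 * X)
    (hs₁ : s₁ ^ 2 + s₁' ^ 2 = 4 * s * X) :
    3 * (r ^ 2 + v ^ 2) ^ 2 * X
        + 3000 * (r ^ 2 + v ^ 2) ^ 2 * (r₁ ^ 2 + v₁ ^ 2 + r₁' ^ 2 + v₁' ^ 2)
        - 1 / 10 * s * (r ^ 2 + v ^ 2) * X ≤
      distSecond s s₁ s₂ r r₁ r₂ v v₁ + distSecond s s₁' s₂' r r₁' r₂' v v₁' := by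
  have hT : 0 ≤ r ^ 2 + v ^ 2 := by positivity
  have hG : 0 ≤ r₁ ^ 2 + v₁ ^ 2 + r₁' ^ 2 + v₁' ^ 2 := by positivity
  have hT₁ : (2 * r * r₁ + 2 * v * v₁) ^ 2 + (2 * r * r₁' + 2 * v * v₁') ^ 2 ≤
      4 * (r ^ 2 + v ^ 2) * (r₁ ^ 2 + v₁ ^ 2 + r₁' ^ 2 + v₁' ^ 2) := by
    nlinarith [sq_nonneg (r * v₁ - v * r₁), sq_nonneg (r * v₁' - v * r₁')]
  have hΔ : 2 * (r₁ ^ 2 + v₁ ^ 2 + r₁' ^ 2 + v₁' ^ 2) - 2 / 10000 * X ≤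
      ((2 * r₁ ^ 2 + 2 * r * r₂) + 2 * v₁ ^ 2) + ((2 * r₁' ^ 2 + 2 * r * r₂') + 2 * v₁' ^ 2) := by
    have hrα : r * α ≤ 1 / 20000 := by
      nlinarith [(abs_le.1 hr).1, (abs_le.1 hr).2, abs_nonneg r]
    have e : 2 * r * r₂ + 2 * r * r₂' = -(4 * (r * α) * X) := by
      rw [← mul_add, hr₂]; ring
    nlinarith
  unfold distSecond
  generalize 2 * r * r₁ + 2 * v * v₁ = T₁ at *
  generalize 2 * r * r₁' + 2 * v * v₁' = T₁' at *
  generalize (2 * r₁ ^ 2 + 2 * r * r₂) + 2 * v₁ ^ 2 = T₂ at *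
  generalize (2 * r₁' ^ 2 + 2 * r * r₂') + 2 * v₁' ^ 2 = T₂' at *
  generalize r₁ ^ 2 + v₁ ^ 2 + r₁' ^ 2 + v₁' ^ 2 = G at *
  generalize r ^ 2 + v ^ 2 = T at *
  have hcross : -(3000 * T ^ 2 * G + 1 / 20 * s * T * X) ≤ 4 * T * (s₁ * T₁ + s₁' * T₁') := by
    refine (abs_le_of_sq_le_sq' ?_ (by positivity)).1
    have hcs : (s₁ * T₁ + s₁' * T₁') ^ 2 ≤ (4 * s * X) * (4 * T * G) :=
      calc (s₁ * T₁ + s₁' * T₁') ^ 2 ≤ (s₁ ^ 2 + s₁' ^ 2) * (T₁ ^ 2 + T₁' ^ 2) := by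
            nlinarith [sq_nonneg (s₁ * T₁' - s₁' * T₁)]
        _ ≤ (4 * s * X) * (4 * T * G) := by rw [hs₁]; gcongr
    calc (4 * T * (s₁ * T₁ + s₁' * T₁')) ^ 2 = 16 * T ^ 2 * (s₁ * T₁ + s₁' * T₁') ^ 2 := by ring
      _ ≤ 16 * T ^ 2 * ((4 * s * X) * (4 * T * G)) := by gcongr
      _ ≤ (3000 * T ^ 2 * G + 1 / 20 * s * T * X) ^ 2 := by
        have : 0 ≤ T ^ 3 * G * s * X := by positivity
        nlinarith [sq_nonneg (3000 * T ^ 2 * G - 1 / 20 * s * T * X)]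
  have hlap := mul_le_mul_of_nonneg_left hΔ
    (show 0 ≤ 2 * s * T + 3000 * T ^ 2 by positivity)
  have hsq : 0 ≤ (2 * s + 6000 * T) * (T₁ ^ 2 + T₁' ^ 2) := by positivity
  have hs₂T : s₂ * T ^ 2 + s₂' * T ^ 2 = 4 * X * T ^ 2 := by rw [← add_mul, hs₂]
  have e1 : 0 ≤ s * T * X := by positivity
  have e2 : 0 ≤ T ^ 2 * X := by positivity
  have e3 : 0 ≤ s * T * G := by positivity
  linarith

/-- The squared distance `(u - q)² + v²` of `w = u + iv` to the value `q` over `z = x + iy`. -/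
def vertDistSq (α x y u v : ℝ) : ℝ :=
  (u - ((1 + α) * x ^ 2 - (1 - α) * y ^ 2) / 2) ^ 2 + v ^ 2

/-- The defining function in the variables `z = x + iy` and `w = u + iv`. -/
def coreFun (α x y u v : ℝ) : ℝ :=
  ((x ^ 2) ^ 2 + 60 * (x ^ 2 * y ^ 2) + 4 * (y ^ 2) ^ 2)
      * (u - ((1 + α) * x ^ 2 - (1 - α) * y ^ 2) / 2) ^ 2
    + 10 ^ 6 * (v ^ 2 * (x ^ 2 + y ^ 2) ^ 2) + 10 ^ 14 * (v ^ 2) ^ 2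
    + ((x ^ 2 + y ^ 2) * vertDistSq α x y u v ^ 2
      + 1000 * (vertDistSq α x y u v * vertDistSq α x y u v ^ 2))

/-- The second derivative of `coreFun` in the direction `(x₁, y₁, u₁, v₁)`. -/
def coreSecond (α x y u v x₁ y₁ u₁ v₁ : ℝ) : ℝ :=
  weightSqSecond α x y u x₁ y₁ u₁ + 10 ^ 6 * imSqSecond x y v x₁ y₁ v₁
    + 10 ^ 14 * (12 * v ^ 2 * v₁ ^ 2)
    + distSecond (x ^ 2 + y ^ 2) (2 * x * x₁ + 2 * y * y₁) (2 * x₁ ^ 2 + 2 * y₁ ^ 2)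
      (u - ((1 + α) * x ^ 2 - (1 - α) * y ^ 2) / 2)
      (u₁ - ((1 + α) * x * x₁ - (1 - α) * y * y₁))
      (-((1 + α) * x₁ ^ 2 - (1 - α) * y₁ ^ 2)) v v₁

theorem hasTwoJet_coreFun (α x y u v x₁ y₁ u₁ v₁ : ℝ) :
    ∃ b, HasTwoJet
      (fun t => coreFun α (x + t * x₁) (y + t * y₁) (u + t * u₁) (v + t * v₁))
      (coreFun α x y u v) b (coreSecond α x y u v x₁ y₁ u₁ v₁) := by
  have jX := (HasTwoJet.line x x₁).sq
  have jY := (HasTwoJet.line y y₁).sq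
  have jV := (HasTwoJet.line v v₁).sq
  have jr := (HasTwoJet.line u u₁).sub
    (((jX.const_mul (1 + α)).sub (jY.const_mul (1 - α))).mul (HasTwoJet.const 2⁻¹))
  have jm := (jX.sq.add ((jX.mul jY).const_mul 60)).add (jY.sq.const_mul 4)
  have jT := jr.sq.add jV
  have j := (((jm.mul jr.sq).add ((jV.mul (jX.add jY).sq).const_mul (10 ^ 6))).add
    (jV.sq.const_mul (10 ^ 14))).add
    (((jX.add jY).mul jT.sq).add ((jT.mul jT.sq).const_mul 1000))
  refine ⟨_, HasTwoJet.congr_jet j ?_ rfl ?_⟩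
  · simp only [coreFun, vertDistSq]; ring
  · simp only [coreSecond, weightSqSecond, imSqSecond, distSecond]; ring

theorem coreFun_nonneg (α x y u v : ℝ) : 0 ≤ coreFun α x y u v := by
  unfold coreFun vertDistSq; positivity

theorem vertDistSq_nonneg (α x y u v : ℝ) : 0 ≤ vertDistSq α x y u v := by
  unfold vertDistSq; positivity

theorem coreFun_eq_zero_iff (α x y u v : ℝ) :
    coreFun α x y u v = 0 ↔ u = ((1 + α) * x ^ 2 - (1 - α) * y ^ 2) / 2 ∧ v = 0 := by
  constructor
  · intro h
    have hT : vertDistSq α x y u v = 0 := by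
      by_contra hne
      have hpos := lt_of_le_of_ne (vertDistSq_nonneg α x y u v) (Ne.symm hne)
      have : 0 < coreFun α x y u v := by unfold coreFun; positivity
      exact this.ne' h
    unfold vertDistSq at hT
    constructor
    · have : (u - ((1 + α) * x ^ 2 - (1 - α) * y ^ 2) / 2) ^ 2 = 0 := by
        nlinarith [sq_nonneg v, sq_nonneg (u - ((1 + α) * x ^ 2 - (1 - α) * y ^ 2) / 2)]
      linarith [pow_eq_zero_iff (two_ne_zero) |>.1 this]
    · have : v ^ 2 = 0 := by
        nlinarith [sq_nonneg v, sq_nonneg (u - ((1 + α) * x ^ 2 - (1 - α) * y ^ 2) / 2)]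
      exact pow_eq_zero_iff (two_ne_zero) |>.1 this
  · rintro ⟨rfl, rfl⟩
    simp [coreFun, vertDistSq]

theorem coreSecond_add_ge {α x y u v : ℝ} (h0 : 0 ≤ α) (h1 : α < 0.46)
    (hB : x ^ 2 + y ^ 2 + u ^ 2 + v ^ 2 < 1 / 10 ^ 10) (ξ₁ ξ₂ η₁ η₂ : ℝ) :
    1 / 5 * (x ^ 2 + y ^ 2) ^ 3 * (ξ₁ ^ 2 + ξ₂ ^ 2)
      + (x ^ 2 + y ^ 2) ^ 2 * (η₁ ^ 2 + η₂ ^ 2)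
      + vertDistSq α x y u v ^ 2 * (ξ₁ ^ 2 + ξ₂ ^ 2)
      + vertDistSq α x y u v ^ 2 * ((η₁ - ((1 + α) * x * ξ₁ - (1 - α) * y * ξ₂)) ^ 2 + η₂ ^ 2
        + (-η₂ - ((1 + α) * x * (-ξ₂) - (1 - α) * y * ξ₁)) ^ 2 + η₁ ^ 2) ≤
      coreSecond α x y u v ξ₁ ξ₂ η₁ η₂ + coreSecond α x y u v (-ξ₂) ξ₁ (-η₂) η₁ := by
  have hs : 0 ≤ x ^ 2 + y ^ 2 := by positivity
  have hX : 0 ≤ ξ₁ ^ 2 + ξ₂ ^ 2 := by positivity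
  have hq := quadForm_sq_le h0 h1 x y
  have hT : (u - ((1 + α) * x ^ 2 - (1 - α) * y ^ 2) / 2) ^ 2 + v ^ 2 ≤
      2 * u ^ 2 + 2 * (x ^ 2 + y ^ 2) ^ 2 + v ^ 2 := by
    nlinarith [sq_nonneg (u + ((1 + α) * x ^ 2 - (1 - α) * y ^ 2) / 2)]
  have hr : |u - ((1 + α) * x ^ 2 - (1 - α) * y ^ 2) / 2| ≤ 1 / 10000 := by
    have hu : |u| ≤ 1 / 10 ^ 5 :=
      abs_le_of_sq_le_sq (by nlinarith [sq_nonneg v]) (by norm_num)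
    have hq' : |((1 + α) * x ^ 2 - (1 - α) * y ^ 2) / 2| ≤ 1 / 10 ^ 5 := by
      refine (abs_le_of_sq_le_sq hq hs).trans ?_
      nlinarith [sq_nonneg u, sq_nonneg v]
    exact (abs_sub _ _).trans (by linarith)
  have hf := weightSqSecond_add_ge h0 h1 x y u ξ₁ ξ₂ η₁ η₂
  have hv := imSqSecond_add_ge x y v ξ₁ ξ₂ η₁ η₂
  have hd := distSecond_add_ge (v := v) (s₁ := 2 * x * ξ₁ + 2 * y * ξ₂)
    (s₂ := 2 * ξ₁ ^ 2 + 2 * ξ₂ ^ 2) (s₁' := 2 * x * (-ξ₂) + 2 * y * ξ₁)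
    (s₂' := 2 * (-ξ₂) ^ 2 + 2 * ξ₁ ^ 2)
    (r₁ := η₁ - ((1 + α) * x * ξ₁ - (1 - α) * y * ξ₂))
    (r₁' := -η₂ - ((1 + α) * x * (-ξ₂) - (1 - α) * y * ξ₁))
    (r₂ := -((1 + α) * ξ₁ ^ 2 - (1 - α) * ξ₂ ^ 2))
    (r₂' := -((1 + α) * (-ξ₂) ^ 2 - (1 - α) * ξ₁ ^ 2)) (v₁ := η₂) (v₁' := η₁)
    h0 h1 hs hX hr (by ring) (by ring) (by ring)
  unfold coreSecond vertDistSq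
  have hG : 0 ≤ (η₁ - ((1 + α) * x * ξ₁ - (1 - α) * y * ξ₂)) ^ 2 + η₂ ^ 2
      + (-η₂ - ((1 + α) * x * (-ξ₂) - (1 - α) * y * ξ₁)) ^ 2 + η₁ ^ 2 := by positivity
  generalize distSecond _ _ _ _ _ _ _ _ = d₁ at *
  generalize distSecond _ _ _ _ _ _ _ _ = d₂ at *
  generalize weightSqSecond _ _ _ _ _ _ _ = f₁ at *
  generalize weightSqSecond _ _ _ _ _ _ _ = f₂ at *
  generalize imSqSecond _ _ _ _ _ _ = g₁ at *
  generalize imSqSecond _ _ _ _ _ _ = g₂ at *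
  generalize (η₁ - ((1 + α) * x * ξ₁ - (1 - α) * y * ξ₂)) ^ 2 + η₂ ^ 2
      + (-η₂ - ((1 + α) * x * (-ξ₂) - (1 - α) * y * ξ₁)) ^ 2 + η₁ ^ 2 = G at *
  have hT0 : 0 ≤ (u - ((1 + α) * x ^ 2 - (1 - α) * y ^ 2) / 2) ^ 2 + v ^ 2 := by positivity
  generalize (u - ((1 + α) * x ^ 2 - (1 - α) * y ^ 2) / 2) ^ 2 + v ^ 2 = T at *
  generalize ξ₁ ^ 2 + ξ₂ ^ 2 = X at *
  generalize x ^ 2 + y ^ 2 = s at *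
  have hH : 0 ≤ η₁ ^ 2 + η₂ ^ 2 := by positivity
  have hsT := mul_le_mul_of_nonneg_left hT (mul_nonneg hs hX)
  have p1 : 0 ≤ s * v ^ 2 * X := by positivity
  have p2 : 0 ≤ s * u ^ 2 * X := by positivity
  have p3 : 0 ≤ s ^ 2 * (η₁ ^ 2 + η₂ ^ 2) := by positivity
  have p4 : 0 ≤ v ^ 2 * (η₁ ^ 2 + η₂ ^ 2) := by positivity
  have p5 : 0 ≤ T ^ 2 * X := by positivity
  have p6 : 0 ≤ T ^ 2 * G := by positivity
  have p7 : 0 ≤ s ^ 3 * X := by positivity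
  linarith

theorem coreSecond_add_nonneg {α x y u v : ℝ} (h0 : 0 ≤ α) (h1 : α < 0.46)
    (hB : x ^ 2 + y ^ 2 + u ^ 2 + v ^ 2 < 1 / 10 ^ 10) (ξ₁ ξ₂ η₁ η₂ : ℝ) :
    0 ≤ coreSecond α x y u v ξ₁ ξ₂ η₁ η₂ + coreSecond α x y u v (-ξ₂) ξ₁ (-η₂) η₁ :=
  le_trans (by positivity) (coreSecond_add_ge h0 h1 hB ξ₁ ξ₂ η₁ η₂)

theorem coreSecond_add_pos {α x y u v : ℝ} (h0 : 0 ≤ α) (h1 : α < 0.46)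
    (hB : x ^ 2 + y ^ 2 + u ^ 2 + v ^ 2 < 1 / 10 ^ 10)
    (hp : 0 < x ^ 2 + y ^ 2 + u ^ 2 + v ^ 2) {ξ₁ ξ₂ η₁ η₂ : ℝ}
    (hd : 0 < ξ₁ ^ 2 + ξ₂ ^ 2 + η₁ ^ 2 + η₂ ^ 2) :
    0 < coreSecond α x y u v ξ₁ ξ₂ η₁ η₂ + coreSecond α x y u v (-ξ₂) ξ₁ (-η₂) η₁ := by
  refine lt_of_lt_of_le ?_ (coreSecond_add_ge h0 h1 hB ξ₁ ξ₂ η₁ η₂)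
  have hX : 0 ≤ ξ₁ ^ 2 + ξ₂ ^ 2 := by positivity
  have hH : 0 ≤ η₁ ^ 2 + η₂ ^ 2 := by positivity
  rcases eq_or_lt_of_le (show 0 ≤ x ^ 2 + y ^ 2 by positivity) with hs | hs
  · have hx : x = 0 := by nlinarith [sq_nonneg x, sq_nonneg y]
    have hy : y = 0 := by nlinarith [sq_nonneg x, sq_nonneg y]
    subst hx hy
    have hT : 0 < u ^ 2 + v ^ 2 := by linarith
    have : 0 < (u ^ 2 + v ^ 2) ^ 2 * ((ξ₁ ^ 2 + ξ₂ ^ 2) + 2 * (η₁ ^ 2 + η₂ ^ 2)) :=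
      mul_pos (by positivity) (by linarith)
    simp only [vertDistSq]
    ring_nf at this ⊢
    exact this
  · refine add_pos_of_pos_of_nonneg (add_pos_of_pos_of_nonneg ?_ (by positivity)) (by positivity)
    rcases eq_or_lt_of_le hX with h | h
    · have : 0 < η₁ ^ 2 + η₂ ^ 2 := by linarith
      positivity
    · positivity

/-- The contribution of `S (1 + B)`, where `S = ∑ (Im w_τ)²` and `B = |z|² + |w|²`, to the Levi
form. Here `S₁`, `S₁'` are the first derivatives of `S` in the directions `v`, `iv`, and `Θ` and
`N` are the squared norms of the components of `v`. -/
theorem transverse_second_ge {S S₁ S₁' Θ B B₁ B₁' N : ℝ} (hS : 0 ≤ S) (hΘ : 0 ≤ Θ) (hN : 0 ≤ N)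
    (hB0 : 0 ≤ B) (hB : B ≤ 1 / 16) (hS₁ : S₁ ^ 2 + S₁' ^ 2 ≤ 4 * S * Θ)
    (hB₁ : B₁ ^ 2 + B₁' ^ 2 ≤ 4 * B * N) :
    Θ + S * N ≤ 2 * Θ * (1 + B) + 2 * (S₁ * B₁ + S₁' * B₁') + S * (4 * N) := by
  have h : -(Θ + S * N) ≤ 2 * (S₁ * B₁ + S₁' * B₁') := by
    refine (abs_le_of_sq_le_sq' ?_ (by positivity)).1
    calc (2 * (S₁ * B₁ + S₁' * B₁')) ^ 2
        ≤ 4 * ((S₁ ^ 2 + S₁' ^ 2) * (B₁ ^ 2 + B₁' ^ 2)) := by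
          nlinarith [sq_nonneg (S₁ * B₁' - S₁' * B₁)]
      _ ≤ 4 * ((4 * S * Θ) * (4 * B * N)) := by gcongr
      _ ≤ 4 * ((4 * S * Θ) * (4 * (1 / 16) * N)) := by gcongr
      _ ≤ (Θ + S * N) ^ 2 := by nlinarith [sq_nonneg (Θ - S * N)]
  have : 0 ≤ Θ * B := by positivity
  have : 0 ≤ S * N := by positivity
  linarith

section DefiningFunction

variable {n : ℕ} (s : Finset (Fin n)) (i j : Fin n) (α : ℝ)

/-- `|Z_i|² + |Z_j|²`. -/
def baseNormSq (Z : EuclideanSpace ℂ (Fin n)) : ℝ :=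
  (Z i).re ^ 2 + (Z i).im ^ 2 + (Z j).re ^ 2 + (Z j).im ^ 2

/-- The defining function, with `z = Z_i`, `w = Z_j` and the `w_τ` indexed by `s`. -/
def definingFun (Z : EuclideanSpace ℂ (Fin n)) : ℝ :=
  coreFun α (Z i).re (Z i).im (Z j).re (Z j).im
    + (∑ l ∈ s, (Z l).im ^ 2) * (1 + baseNormSq i j Z)

theorem contDiff_re_coord (l : Fin n) {m : WithTop ℕ∞} :
    ContDiff ℝ m (fun Z : EuclideanSpace ℂ (Fin n) => (Z l).re) :=
  (Complex.reCLM.comp ((EuclideanSpace.proj l : EuclideanSpace ℂ (Fin n) →L[ℂ] ℂ).restrictScalars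
    ℝ)).contDiff

theorem contDiff_im_coord (l : Fin n) {m : WithTop ℕ∞} :
    ContDiff ℝ m (fun Z : EuclideanSpace ℂ (Fin n) => (Z l).im) :=
  (Complex.imCLM.comp ((EuclideanSpace.proj l : EuclideanSpace ℂ (Fin n) →L[ℂ] ℂ).restrictScalars
    ℝ)).contDiff

theorem contDiff_baseNormSq {m : WithTop ℕ∞} : ContDiff ℝ m (baseNormSq i j) :=
  ((((contDiff_re_coord i).pow 2).add ((contDiff_im_coord i).pow 2)).add
    ((contDiff_re_coord j).pow 2)).add ((contDiff_im_coord j).pow 2)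

theorem contDiff_definingFun {m : WithTop ℕ∞} : ContDiff ℝ m (definingFun s i j α) := by
  have hx := contDiff_re_coord (m := m) i
  have hy := contDiff_im_coord (m := m) i
  have hu := contDiff_re_coord (m := m) j
  have hv := contDiff_im_coord (m := m) j
  have hB := contDiff_baseNormSq (m := m) i j
  have hS : ContDiff ℝ m (fun Z : EuclideanSpace ℂ (Fin n) => ∑ l ∈ s, (Z l).im ^ 2) :=
    ContDiff.sum fun l _ => (contDiff_im_coord l).pow 2
  unfold definingFun coreFun vertDistSq
  fun_prop

theorem hasTwoJet_definingFun (p v : EuclideanSpace ℂ (Fin n)) :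
    ∃ a b, HasTwoJet (fun t : ℝ => definingFun s i j α (p + t • v)) a b
      (coreSecond α (p i).re (p i).im (p j).re (p j).im (v i).re (v i).im (v j).re (v j).im
        + (2 * (∑ l ∈ s, (v l).im ^ 2) * (1 + baseNormSq i j p)
          + 2 * (∑ l ∈ s, 2 * (p l).im * (v l).im)
            * (2 * (p i).re * (v i).re + 2 * (p i).im * (v i).im
              + 2 * (p j).re * (v j).re + 2 * (p j).im * (v j).im)
          + (∑ l ∈ s, (p l).im ^ 2) * (2 * baseNormSq i j v))) := by
  obtain ⟨b, jc⟩ := hasTwoJet_coreFun α (p i).re (p i).im (p j).re (p j).im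
    (v i).re (v i).im (v j).re (v j).im
  have jS := HasTwoJet.sum s fun l _ => (HasTwoJet.line (p l).im (v l).im).sq
  have jB := (((HasTwoJet.line (p i).re (v i).re).sq.add
    (HasTwoJet.line (p i).im (v i).im).sq).add (HasTwoJet.line (p j).re (v j).re).sq).add
    (HasTwoJet.line (p j).im (v j).im).sq
  have J := jc.add (jS.mul ((HasTwoJet.const 1).add jB))
  simp only [definingFun, baseNormSq, PiLp.add_apply, PiLp.smul_apply, Complex.add_re,
    Complex.add_im, Complex.smul_re, Complex.smul_im, smul_eq_mul]
  refine ⟨_, _, J.congr_jet rfl rfl ?_⟩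
  simp only [mul_zero, add_zero, ← Finset.mul_sum]
  ring

theorem sliceLaplacian_definingFun (p v : EuclideanSpace ℂ (Fin n)) :
    sliceLaplacian (definingFun s i j α) p v =
      (coreSecond α (p i).re (p i).im (p j).re (p j).im (v i).re (v i).im (v j).re (v j).im
        + coreSecond α (p i).re (p i).im (p j).re (p j).im
          (-(v i).im) (v i).re (-(v j).im) (v j).re)
      + (2 * (∑ l ∈ s, ((v l).re ^ 2 + (v l).im ^ 2)) * (1 + baseNormSq i j p)
        + 2 * ((∑ l ∈ s, 2 * (p l).im * (v l).im)
            * (2 * (p i).re * (v i).re + 2 * (p i).im * (v i).im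
              + 2 * (p j).re * (v j).re + 2 * (p j).im * (v j).im)
          + (∑ l ∈ s, 2 * (p l).im * (v l).re)
            * (2 * (p i).re * (-(v i).im) + 2 * (p i).im * (v i).re
              + 2 * (p j).re * (-(v j).im) + 2 * (p j).im * (v j).re))
        + (∑ l ∈ s, (p l).im ^ 2) * (4 * baseNormSq i j v)) := by
  have hg : ContDiff ℝ 2 (fun lam : ℂ => definingFun s i j α (p + lam • v)) :=
    (contDiff_definingFun s i j α).comp
      (contDiff_const.add (contDiff_id.smul contDiff_const))
  obtain ⟨_, _, h₁⟩ := hasTwoJet_definingFun s i j α p v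
  obtain ⟨_, _, h₂⟩ := hasTwoJet_definingFun s i j α p (Complex.I • v)
  have e₁ := HasTwoJet.iteratedFDeriv_two hg (e := 1) (by simpa using h₁)
  have e₂ := HasTwoJet.iteratedFDeriv_two hg (e := Complex.I)
    (by simpa only [smul_assoc] using h₂)
  rw [sliceLaplacian, e₁, e₂, Finset.sum_add_distrib]
  simp only [PiLp.smul_apply, smul_eq_mul, Complex.mul_re, Complex.mul_im, Complex.I_re,
    Complex.I_im, zero_mul, one_mul, zero_sub, zero_add, baseNormSq]
  ring

theorem sliceLaplacian_definingFun_ge {p : EuclideanSpace ℂ (Fin n)}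
    (hp : baseNormSq i j p < 1 / 10 ^ 10) (v : EuclideanSpace ℂ (Fin n)) :
    (coreSecond α (p i).re (p i).im (p j).re (p j).im (v i).re (v i).im (v j).re (v j).im
        + coreSecond α (p i).re (p i).im (p j).re (p j).im
          (-(v i).im) (v i).re (-(v j).im) (v j).re)
      + (∑ l ∈ s, ((v l).re ^ 2 + (v l).im ^ 2)
        + (∑ l ∈ s, (p l).im ^ 2) * baseNormSq i j v) ≤
      sliceLaplacian (definingFun s i j α) p v := by
  rw [sliceLaplacian_definingFun]
  refine add_le_add_right (transverse_second_ge (by positivity) (by positivity)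
    (by unfold baseNormSq; positivity) (by unfold baseNormSq; positivity) ?_ ?_ ?_) _
  · exact hp.le.trans (by norm_num)
  · have h₁ := Finset.sum_mul_sq_le_sq_mul_sq s (fun l => (p l).im) (fun l => (v l).im)
    have h₂ := Finset.sum_mul_sq_le_sq_mul_sq s (fun l => (p l).im) (fun l => (v l).re)
    simp only [mul_assoc, ← Finset.mul_sum, Finset.sum_add_distrib]
    linarith
  · unfold baseNormSq
    generalize (p i).re = x, (p i).im = y, (p j).re = u, (p j).im = w,
      (v i).re = a, (v i).im = b, (v j).re = c, (v j).im = d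
    nlinarith [sq_nonneg (a * u - x * c - (b * w - y * d)),
      sq_nonneg (a * w - x * d + (b * u - y * c)),
      sq_nonneg (a * u - x * c + (b * w - y * d)), sq_nonneg (a * w - x * d - (b * u - y * c))]

theorem sliceLaplacian_definingFun_nonneg (h0 : 0 ≤ α) (h1 : α < 0.46)
    {p : EuclideanSpace ℂ (Fin n)} (hp : baseNormSq i j p < 1 / 10 ^ 10)
    (v : EuclideanSpace ℂ (Fin n)) : 0 ≤ sliceLaplacian (definingFun s i j α) p v := by
  refine le_trans (add_nonneg ?_ ?_) (sliceLaplacian_definingFun_ge s i j α hp v)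
  · exact coreSecond_add_nonneg h0 h1 hp _ _ _ _
  · unfold baseNormSq; positivity

theorem sliceLaplacian_definingFun_pos (h0 : 0 ≤ α) (h1 : α < 0.46)
    (hs : ∀ l, l = i ∨ l = j ∨ l ∈ s)
    {p : EuclideanSpace ℂ (Fin n)} (hp : baseNormSq i j p < 1 / 10 ^ 10)
    (hpY : ¬(p i = 0 ∧ p j = 0 ∧ ∀ l ∈ s, (p l).im = 0))
    {v : EuclideanSpace ℂ (Fin n)} (hv : v ≠ 0) :
    0 < sliceLaplacian (definingFun s i j α) p v := by
  refine lt_of_lt_of_le ?_ (sliceLaplacian_definingFun_ge s i j α hp v)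
  have base_nonneg (Z : EuclideanSpace ℂ (Fin n)) : 0 ≤ baseNormSq i j Z := by
    unfold baseNormSq; positivity
  have base_pos (Z : EuclideanSpace ℂ (Fin n)) (hZ : ¬(Z i = 0 ∧ Z j = 0)) :
      0 < baseNormSq i j Z := by
    have e : baseNormSq i j Z = Complex.normSq (Z i) + Complex.normSq (Z j) := by
      rw [baseNormSq, Complex.normSq_apply, Complex.normSq_apply]; ring
    rw [e]
    by_cases h : Z i = 0
    · exact add_pos_of_nonneg_of_pos (Complex.normSq_nonneg _)
        (Complex.normSq_pos.2 fun h' => hZ ⟨h, h'⟩)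
    · exact add_pos_of_pos_of_nonneg (Complex.normSq_pos.2 h) (Complex.normSq_nonneg _)
  have core_nonneg := coreSecond_add_nonneg h0 h1 hp (v i).re (v i).im (v j).re (v j).im
  have hS : 0 ≤ ∑ l ∈ s, (p l).im ^ 2 := by positivity
  have hΘ : 0 ≤ ∑ l ∈ s, ((v l).re ^ 2 + (v l).im ^ 2) := by positivity
  by_cases hvb : v i = 0 ∧ v j = 0
  · have : 0 < ∑ l ∈ s, ((v l).re ^ 2 + (v l).im ^ 2) := by
      obtain ⟨l, hl⟩ : ∃ l, v l ≠ 0 := by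
        by_contra! h
        exact hv (PiLp.ext h)
      have hls : l ∈ s := by
        rcases hs l with rfl | rfl | h
        · exact absurd hvb.1 hl
        · exact absurd hvb.2 hl
        · exact h
      refine Finset.sum_pos' (fun _ _ => by positivity) ⟨l, hls, ?_⟩
      have := Complex.normSq_pos.2 hl
      rw [Complex.normSq_apply] at this
      linarith
    exact add_pos_of_nonneg_of_pos core_nonneg
      (add_pos_of_pos_of_nonneg this (mul_nonneg hS (base_nonneg v)))
  · by_cases hpb : p i = 0 ∧ p j = 0
    · have : 0 < ∑ l ∈ s, (p l).im ^ 2 := by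
        obtain ⟨l, hl, hne⟩ : ∃ l ∈ s, (p l).im ≠ 0 := by
          by_contra! h
          exact hpY ⟨hpb.1, hpb.2, h⟩
        exact Finset.sum_pos' (fun _ _ => by positivity) ⟨l, hl, by positivity⟩
      exact add_pos_of_nonneg_of_pos core_nonneg
        (add_pos_of_nonneg_of_pos hΘ (mul_pos this (base_pos v hvb)))
    · exact add_pos_of_pos_of_nonneg
        (coreSecond_add_pos h0 h1 hp (base_pos p hpb) (base_pos v hvb))
        (add_nonneg hΘ (mul_nonneg hS (base_nonneg v)))

theorem definingFun_nonneg (Z : EuclideanSpace ℂ (Fin n)) : 0 ≤ definingFun s i j α Z := by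
  have := coreFun_nonneg α (Z i).re (Z i).im (Z j).re (Z j).im
  unfold definingFun baseNormSq; positivity

theorem definingFun_eq_zero_iff (Z : EuclideanSpace ℂ (Fin n)) :
    definingFun s i j α Z = 0 ↔ (∀ l ∈ s, (Z l).im = 0) ∧
      Z j = ((α / 2 * Complex.normSq (Z i) : ℝ) : ℂ)
        + (1 / 4 : ℂ) * (Z i ^ 2 + conj (Z i) ^ 2) := by
  have hB : 0 < 1 + baseNormSq i j Z := by unfold baseNormSq; positivity
  have hS : 0 ≤ ∑ l ∈ s, (Z l).im ^ 2 := by positivity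
  rw [definingFun, add_eq_zero_iff_of_nonneg (coreFun_nonneg _ _ _ _ _) (mul_nonneg hS hB.le),
    coreFun_eq_zero_iff, mul_eq_zero, or_iff_left hB.ne',
    Finset.sum_eq_zero_iff_of_nonneg fun l _ => sq_nonneg _, and_comm]
  refine and_congr (by simp) ?_
  have h4 : (1 / 4 : ℂ) = ((1 / 4 : ℝ) : ℂ) := by norm_num
  rw [Complex.ext_iff, h4]
  simp only [Complex.add_re, Complex.add_im, Complex.ofReal_re, Complex.ofReal_im,
    pow_two, Complex.mul_re, Complex.mul_im,
    Complex.conj_re, Complex.conj_im, Complex.normSq_apply]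
  refine and_congr ⟨fun h => ?_, fun h => ?_⟩ ⟨fun h => ?_, fun h => ?_⟩ <;> linarith

end DefiningFunction

/-- **Lemma 5.2.** For each `0 ≤ α < 0.46` there is a neighbourhood `V_α` of the origin in
`ℂ^{2k}` and a smooth p.s.h. function `ρ_α : V_α → ℝ` with `{ρ_α = 0} = S_α ∩ V_α`,
`ρ_α > 0` on `V_α \ S_α`, and `ρ_α` strictly p.s.h. on `V_α \ Y`. -/
theorem slapar_psh_defining_function
    (k : ℕ) (hk : 1 < k) (α : ℝ) (hα0 : 0 ≤ α) (hα : α < 0.46) :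
    ∃ (V : Set (EuclideanSpace ℂ (Fin (2*k)))) (ρ : EuclideanSpace ℂ (Fin (2*k)) → ℝ),
      IsOpen V ∧ (0 : EuclideanSpace ℂ (Fin (2*k))) ∈ V ∧
      ContDiffOn ℝ (⊤ : ℕ∞) ρ V ∧ PshOn ρ V ∧
      {z ∈ V | ρ z = 0} = slaparSurface k hk α ∩ V ∧
      (∀ z ∈ V \ slaparSurface k hk α, 0 < ρ z) ∧
      StrictPshOn ρ (V \ slaparSingularSet k hk) := by
  have h0 : 0 < 2 * k := by omega
  have hl : 2 * k - 1 < 2 * k := by omega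
  set i : Fin (2 * k) := ⟨0, h0⟩ with hi
  set j : Fin (2 * k) := ⟨2 * k - 1, hl⟩ with hj
  let s : Finset (Fin (2 * k)) := {l | l ≠ i ∧ l ≠ j}
  have hs (P : Fin (2 * k) → Prop) : (∀ l ∈ s, P l) ↔
      ∀ τ : ℕ, ∀ _h1 : 1 ≤ τ, ∀ _h2 : τ ≤ 2 * k - 2, P ⟨τ, by omega⟩ := by
    simp only [s, Finset.mem_filter, Finset.mem_univ, true_and, hi, hj, ne_eq, Fin.ext_iff]
    constructor
    · intro h τ h1 h2
      exact h ⟨τ, by omega⟩ ⟨by simp only; omega, by simp only; omega⟩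
    · rintro h ⟨l, hl⟩ ⟨h1, h2⟩
      simp only at h1 h2
      exact h l (by omega) (by omega)
  have hzero (Z : EuclideanSpace ℂ (Fin (2 * k))) :
      definingFun s i j α Z = 0 ↔ Z ∈ slaparSurface k hk α := by
    rw [definingFun_eq_zero_iff, hs]; rfl
  refine ⟨{Z | baseNormSq i j Z < 1 / 10 ^ 10}, definingFun s i j α, ?_, ?_,
    (contDiff_definingFun s i j α).contDiffOn, ?_, ?_, ?_, ?_⟩
  · exact isOpen_lt (contDiff_baseNormSq (m := 0) i j).continuous continuous_const
  · simp [baseNormSq]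
  · exact fun p hp v => sliceLaplacian_definingFun_nonneg s i j α hα0 hα hp v
  · ext Z
    rw [Set.mem_sep_iff, hzero, and_comm]; rfl
  · rintro Z ⟨-, hZ⟩
    exact lt_of_le_of_ne (definingFun_nonneg s i j α Z) fun h => hZ ((hzero Z).1 h.symm)
  · rintro p ⟨hp, hpY⟩ v hv
    refine sliceLaplacian_definingFun_pos s i j α hα0 hα (fun l => ?_) hp ?_ hv
    · simp only [s, Finset.mem_filter, Finset.mem_univ, true_and]
      tauto
    · rintro ⟨hz, hw, him⟩
      exact hpY ⟨hz, (hs _).1 him, hw⟩
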